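/- For all words w, w′ ∈ W, the operators Φ(w) and Φ(w′) on P are equal if and only if w ≈ w′. Equivalently, the operators T_i and R_i satisfy the defining relations of 𝕋̃, and the induced monoid homomorphism 𝕋̃ → End(P) is injective (the polynomial representation of the augmented Thompson monoid is faithful). -/

import Mathlib

/-!
Statement 9.  `P = ℤ[x₁, x₂, …]` (variables indexed by positive integers), with the
Bergeron–Sottile maps `R_i` and quasisymmetric divided differences `T_i`
(characterized by `x_i·(T_i f) = R_{i+1} f − R_i f`).  `W` is the free monoid on
`{g_i} ∪ {h_i}` and `≈` the congruence generated by the augmented Thompson relations.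
`Φ(a₁⋯a_k) = up(a₁) ∘ ⋯ ∘ up(a_k)` with `up(g_i) = T_i`, `up(h_i) = R_i`.
Claim: `Φ(w) = Φ(w′)` if and only if `w ≈ w′` (the polynomial representation of the
augmented Thompson monoid is faithful).
-/

/-- The polynomial ring `ℤ[x₁, x₂, …]` with variables indexed by the positive integers. -/
abbrev PolyP : Type := MvPolynomial ℕ+ ℤ

/-- The Bergeron–Sottile map `R_i : P → P`,
`f(x₁, x₂, …) ↦ f(x₁, …, x_{i−1}, 0, x_i, x_{i+1}, …)`. -/
noncomputable def Rop (i : ℕ+) : PolyP →ₐ[ℤ] PolyP :=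
  MvPolynomial.aeval (fun j : ℕ+ =>
    if j < i then MvPolynomial.X j
    else if j = i then 0
    else MvPolynomial.X (j - 1))

/-- The alphabet `{g_i : i ≥ 1} ∪ {h_i : i ≥ 1}`. -/
inductive Letter : Type
  | g : ℕ+ → Letter
  | h : ℕ+ → Letter

/-- The free monoid on the alphabet. -/
abbrev W : Type := FreeMonoid Letter

open FreeMonoid in
/-- The defining relations of the augmented Thompson monoid. -/
inductive thompsonRel : W → W → Prop
  | gg (i j : ℕ+) : i > j →
      thompsonRel (of (.g i) * of (.g j)) (of (.g j) * of (.g (i + 1)))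
  | gh (i j : ℕ+) : i ≥ j →
      thompsonRel (of (.g i) * of (.h j)) (of (.h j) * of (.g (i + 1)))
  | hg (i j : ℕ+) : i > j →
      thompsonRel (of (.h i) * of (.g j)) (of (.g j) * of (.h (i + 1)))
  | hh (i j : ℕ+) : i ≥ j →
      thompsonRel (of (.h i) * of (.h j)) (of (.h j) * of (.h (i + 1)))

/-- Interpretation of a letter as a ℤ-linear endomorphism of `P`:
`up(g_i) = T_i` and `up(h_i) = R_i`. -/
noncomputable def up (T : ℕ+ → Module.End ℤ PolyP) : Letter → Module.End ℤ PolyP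
  | .g i => T i
  | .h i => (Rop i).toLinearMap

/-- `Φ : W → End(P)`, `Φ(a₁⋯a_k) = up(a₁) ∘ up(a₂) ∘ ⋯ ∘ up(a_k)`
(monoid multiplication in `End(P)` is composition). -/
noncomputable def Phi (T : ℕ+ → Module.End ℤ PolyP) : W →* Module.End ℤ PolyP :=
  FreeMonoid.lift (up T)

theorem PNat.exists_eq_add_one_of_lt {i j : ℕ+} (h : i < j) : ∃ k, j = k + 1 ∧ i ≤ k := by
  obtain ⟨k, rfl⟩ := PNat.exists_eq_succ_of_ne_one (one_lt_of_gt h).ne'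
  exact ⟨k, rfl, PNat.lt_add_one_iff.1 h⟩

namespace Rop

open MvPolynomial

theorem X_of_lt {i j : ℕ+} (h : j < i) : Rop i (X j) = X j := by
  simp [Rop, h]

theorem X_self (i : ℕ+) : Rop i (X i) = 0 := by
  simp [Rop]

theorem X_add_one_of_le {i j : ℕ+} (h : i ≤ j) : Rop i (X (j + 1)) = X j := by
  have h' : i < j + 1 := PNat.lt_add_one_iff.2 h
  have h2 : j + 1 - 1 = j := PNat.add_sub
  simp [Rop, h'.not_gt, h'.ne', h2]

theorem comm {i j : ℕ+} (h : j ≤ i) (f : PolyP) :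
    Rop i (Rop j f) = Rop j (Rop (i + 1) f) := by
  suffices (Rop i).comp (Rop j) = (Rop j).comp (Rop (i + 1)) from DFunLike.congr_fun this f
  refine MvPolynomial.algHom_ext fun k => ?_
  simp only [AlgHom.comp_apply]
  rcases lt_trichotomy k j with hk | rfl | hk
  · rw [X_of_lt hk, X_of_lt (hk.trans_le h),
      X_of_lt ((hk.trans_le h).trans (PNat.lt_add_right i 1)), X_of_lt hk]
  · rw [X_self, X_of_lt (PNat.lt_add_one_iff.2 h), X_self, map_zero]
  · obtain ⟨k, rfl, hjk⟩ := PNat.exists_eq_add_one_of_lt hk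
    rw [X_add_one_of_le hjk]
    rcases lt_trichotomy k i with hi | rfl | hi
    · rw [X_of_lt hi, X_of_lt (add_lt_add_left hi 1), X_add_one_of_le hjk]
    · rw [X_self, X_self, map_zero]
    · obtain ⟨k, rfl, hik⟩ := PNat.exists_eq_add_one_of_lt hi
      rw [X_add_one_of_le hik, X_add_one_of_le (add_le_add_left hik 1),
        X_add_one_of_le (h.trans hik)]

theorem surjective (i : ℕ+) : Function.Surjective (Rop i) := by
  intro f
  refine ⟨aeval (fun j : ℕ+ => if j < i then (X j : PolyP) else X (j + 1)) f, ?_⟩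
  suffices (Rop i).comp (aeval (fun j : ℕ+ => if j < i then (X j : PolyP) else X (j + 1))) =
      AlgHom.id ℤ PolyP from DFunLike.congr_fun this f
  refine MvPolynomial.algHom_ext fun k => ?_
  simp only [AlgHom.comp_apply, aeval_X, AlgHom.id_apply]
  split_ifs with h
  · exact X_of_lt h
  · exact X_add_one_of_le (not_lt.1 h)

end Rop

/-- `T` is the family of quasisymmetric divided differences. -/
def IsDividedDifference (T : ℕ+ → Module.End ℤ PolyP) : Prop :=
  ∀ (i : ℕ+) (f : PolyP), (MvPolynomial.X i : PolyP) * T i f = Rop (i + 1) f - Rop i f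

namespace IsDividedDifference

open MvPolynomial

variable {T : ℕ+ → Module.End ℤ PolyP} (hT : IsDividedDifference T)

include hT

theorem eq_of_X_mul_eq {i : ℕ+} {f g : PolyP} (h : X i * g = Rop (i + 1) f - Rop i f) :
    T i f = g :=
  mul_left_cancel₀ (X_ne_zero i) ((hT i f).trans h.symm)

theorem X_mul_of_lt {i j : ℕ+} (h : j < i) (f : PolyP) : T i (X j * f) = X j * T i f := by
  apply hT.eq_of_X_mul_eq
  rw [map_mul, map_mul, Rop.X_of_lt h, Rop.X_of_lt (h.trans (PNat.lt_add_right i 1)),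
    mul_left_comm, hT, mul_sub]

theorem X_add_one_mul_of_lt {i j : ℕ+} (h : i < j) (f : PolyP) :
    T i (X (j + 1) * f) = X j * T i f := by
  apply hT.eq_of_X_mul_eq
  rw [map_mul, map_mul, Rop.X_add_one_of_le h.le, Rop.X_add_one_of_le (PNat.add_one_le_iff.2 h),
    mul_left_comm, hT, mul_sub]

theorem X_self_mul (i : ℕ+) (f : PolyP) : T i (X i * f) = Rop (i + 1) f := by
  apply hT.eq_of_X_mul_eq
  rw [map_mul, map_mul, Rop.X_self, Rop.X_of_lt (PNat.lt_add_right i 1), zero_mul, sub_zero]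

theorem X_add_one_mul (i : ℕ+) (f : PolyP) : T i (X (i + 1) * f) = -Rop i f := by
  apply hT.eq_of_X_mul_eq
  rw [map_mul, map_mul, Rop.X_self, Rop.X_add_one_of_le le_rfl, zero_mul, zero_sub, mul_neg]

theorem surjective (i : ℕ+) : Function.Surjective (T i) := by
  intro f
  obtain ⟨g, rfl⟩ := Rop.surjective (i + 1) f
  exact ⟨X i * g, hT.X_self_mul i g⟩

theorem comm_Rop {i j : ℕ+} (h : j ≤ i) (f : PolyP) :
    T i (Rop j f) = Rop j (T (i + 1) f) := by
  apply hT.eq_of_X_mul_eq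
  rw [Rop.comm h, Rop.comm (h.trans (PNat.lt_add_right i 1).le), ← map_sub, ← hT, map_mul,
    Rop.X_add_one_of_le h]

theorem Rop_comm {i j : ℕ+} (h : j < i) (f : PolyP) :
    Rop i (T j f) = T j (Rop (i + 1) f) := by
  symm
  apply hT.eq_of_X_mul_eq
  rw [← Rop.comm h.le, ← Rop.comm (PNat.add_one_le_iff.2 h), ← map_sub, ← hT, map_mul,
    Rop.X_of_lt h]

theorem comm {i j : ℕ+} (h : j < i) (f : PolyP) : T i (T j f) = T j (T (i + 1) f) := by
  apply hT.eq_of_X_mul_eq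
  rw [hT.Rop_comm h, hT.Rop_comm (h.trans (PNat.lt_add_right i 1)), ← map_sub, ← hT,
    hT.X_add_one_mul_of_lt h]

end IsDividedDifference

namespace Phi

open MvPolynomial FreeMonoid

theorem one_apply (T : ℕ+ → Module.End ℤ PolyP) (f : PolyP) : Phi T 1 f = f := by
  simp

theorem mul_of_g_apply (T : ℕ+ → Module.End ℤ PolyP) (w : W) (i : ℕ+) (f : PolyP) :
    Phi T (w * of (.g i)) f = Phi T w (T i f) := by
  simp [Phi, up]

theorem mul_of_h_apply (T : ℕ+ → Module.End ℤ PolyP) (w : W) (i : ℕ+) (f : PolyP) :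
    Phi T (w * of (.h i)) f = Phi T w (Rop i f) := by
  simp [Phi, up]

theorem word_induction {motive : W → Prop} (one : motive 1)
    (mul_g : ∀ w i, motive w → motive (w * of (.g i)))
    (mul_h : ∀ w i, motive w → motive (w * of (.h i))) (w : W) : motive w := by
  induction w using List.reverseRecOn with
  | nil => exact one
  | append_singleton w a ih =>
    cases a with
    | g i => exact mul_g w i ih
    | h i => exact mul_h w i ih

variable {T : ℕ+ → Module.End ℤ PolyP} (hT : IsDividedDifference T)

include hT

theorem eq_of_conGen {w w' : W} (h : conGen thompsonRel w w') : Phi T w = Phi T w' := by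
  suffices conGen thompsonRel ≤ Con.ker (Phi T) from (Con.ker_rel _).1 (this h)
  refine Con.conGen_le.2 fun u v huv => ?_
  refine (Con.ker_rel _).2 ?_
  cases huv with
  | gg i j h => exact LinearMap.ext fun f => by simpa [Phi, up] using hT.comm h f
  | gh i j h => exact LinearMap.ext fun f => by simpa [Phi, up] using hT.comm_Rop h f
  | hg i j h => exact LinearMap.ext fun f => by simpa [Phi, up] using hT.Rop_comm h f
  | hh i j h => exact LinearMap.ext fun f => by simpa [Phi, up] using Rop.comm h f

theorem surjective (w : W) : Function.Surjective (Phi T w) := by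
  induction w using word_induction with
  | one => exact fun f => ⟨f, one_apply T f⟩
  | mul_g w i ih =>
    simpa only [Function.Surjective, mul_of_g_apply, Function.comp_apply] using
      ih.comp (hT.surjective i)
  | mul_h w i ih =>
    simpa only [Function.Surjective, mul_of_h_apply, Function.comp_apply] using
      ih.comp (Rop.surjective i)

theorem not_forall_eq_zero (w : W) : ¬ ∀ f, Phi T w f = 0 := by
  intro h
  obtain ⟨f, hf⟩ := surjective hT w 1
  exact one_ne_zero (hf.symm.trans (h f))

omit hT in
theorem conGen_swap {u w : W} {a b c d : Letter} (h : conGen thompsonRel w (u * of a))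
    (hr : conGen thompsonRel (of a * of b) (of c * of d)) :
    conGen thompsonRel (w * of b) (u * of c * of d) := by
  have h1 := (conGen thompsonRel).mul h ((conGen thompsonRel).refl (of b))
  have h2 := (conGen thompsonRel).mul ((conGen thompsonRel).refl u) hr
  rw [mul_assoc] at h1 ⊢
  exact (conGen thompsonRel).trans h1 h2

/-- A word acting by zero on the multiples of `X j` is right divisible by `h_j`. -/
theorem exists_conGen_mul_h (w : W) (j : ℕ+) (hw : ∀ f, Phi T w (X j * f) = 0) :
    ∃ u, conGen thompsonRel w (u * of (.h j)) := by
  induction w using word_induction generalizing j with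
  | one => exact absurd (by simpa using hw 1) (X_ne_zero (R := ℤ) j)
  | mul_g w i ih =>
    simp only [mul_of_g_apply] at hw
    rcases lt_trichotomy j i with h | rfl | h
    · simp only [hT.X_mul_of_lt h] at hw
      obtain ⟨u, hu⟩ := ih j ((hT.surjective i).forall.2 hw)
      obtain ⟨i, rfl, hi⟩ := PNat.exists_eq_add_one_of_lt h
      exact ⟨_, conGen_swap hu ((conGen thompsonRel).symm (.of _ _ (.gh i j hi)))⟩
    · simp only [hT.X_self_mul] at hw
      exact absurd ((Rop.surjective _).forall.2 hw) (not_forall_eq_zero hT w)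
    · obtain ⟨j, rfl, hj⟩ := PNat.exists_eq_add_one_of_lt h
      rcases hj.eq_or_lt with rfl | hj
      · simp only [hT.X_add_one_mul, map_neg, neg_eq_zero] at hw
        exact absurd ((Rop.surjective _).forall.2 hw) (not_forall_eq_zero hT w)
      · simp only [hT.X_add_one_mul_of_lt hj] at hw
        obtain ⟨u, hu⟩ := ih j ((hT.surjective i).forall.2 hw)
        exact ⟨_, conGen_swap hu (.of _ _ (.hg j i hj))⟩
  | mul_h w i ih =>
    simp only [mul_of_h_apply] at hw
    simp only [map_mul (Rop i)] at hw
    rcases lt_trichotomy j i with h | rfl | h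
    · simp only [Rop.X_of_lt h] at hw
      obtain ⟨u, hu⟩ := ih j ((Rop.surjective i).forall.2 hw)
      obtain ⟨i, rfl, hi⟩ := PNat.exists_eq_add_one_of_lt h
      exact ⟨_, conGen_swap hu ((conGen thompsonRel).symm (.of _ _ (.hh i j hi)))⟩
    · exact ⟨w, (conGen thompsonRel).refl _⟩
    · obtain ⟨j, rfl, hj⟩ := PNat.exists_eq_add_one_of_lt h
      simp only [Rop.X_add_one_of_le hj] at hw
      obtain ⟨u, hu⟩ := ih j ((Rop.surjective i).forall.2 hw)
      exact ⟨_, conGen_swap hu (.of _ _ (.hh j i hj))⟩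

/-- A word acting by zero on the multiples of `X j * X (j + 1)`, but not on those of `X j` or
of `X (j + 1)`, is right divisible by `g_j`. -/
theorem exists_conGen_mul_g (w : W) (j : ℕ+) (hw : ∀ f, Phi T w (X j * (X (j + 1) * f)) = 0)
    (hj : ¬ ∀ f, Phi T w (X j * f) = 0) (hj' : ¬ ∀ f, Phi T w (X (j + 1) * f) = 0) :
    ∃ u, conGen thompsonRel w (u * of (.g j)) := by
  induction w using word_induction generalizing j with
  | one =>
    exact absurd (by simpa using hw 1)
      (mul_ne_zero (X_ne_zero (R := ℤ) j) (X_ne_zero (R := ℤ) (j + 1)))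
  | mul_g w i ih =>
    simp only [mul_of_g_apply] at hw hj hj'
    rcases lt_trichotomy j i with h | rfl | h
    · obtain ⟨i, rfl, hi⟩ := PNat.exists_eq_add_one_of_lt h
      simp only [hT.X_mul_of_lt h] at hw hj
      rcases hi.eq_or_lt with rfl | hi
      · simp only [hT.X_self_mul] at hw
        exact absurd (fun f => (Rop.surjective (j + 1 + 1)).forall
          (p := fun f => Phi T w (X j * f) = 0)
          |>.2 hw _) hj
      · have hi' : j + 1 < i + 1 := add_lt_add_left hi 1
        simp only [hT.X_mul_of_lt hi'] at hw hj'
        have hS := hT.surjective (i + 1)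
        rw [← hS.forall (p := fun f => Phi T w (X j * f) = 0)] at hj
        rw [← hS.forall (p := fun f => Phi T w (X (j + 1) * f) = 0)] at hj'
        obtain ⟨u, hu⟩ := ih j (hS.forall.2 hw) hj hj'
        exact ⟨_, conGen_swap hu ((conGen thompsonRel).symm (.of _ _ (.gg i j hi)))⟩
    · exact ⟨w, (conGen thompsonRel).refl _⟩
    · obtain ⟨j, rfl, hij⟩ := PNat.exists_eq_add_one_of_lt h
      simp only [hT.X_add_one_mul_of_lt h] at hj'
      rcases hij.eq_or_lt with rfl | hij
      · simp only [mul_left_comm (X (i + 1) : PolyP), hT.X_add_one_mul_of_lt h,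
          hT.X_add_one_mul, mul_neg, map_neg, neg_eq_zero] at hw
        exact absurd (fun f => (Rop.surjective i).forall (p := fun f => Phi T w (X (i + 1) * f) = 0)
          |>.2 hw _) hj'
      · simp only [hT.X_add_one_mul_of_lt hij, hT.X_add_one_mul_of_lt h] at hw hj
        have hS := hT.surjective i
        rw [← hS.forall (p := fun f => Phi T w (X j * f) = 0)] at hj
        rw [← hS.forall (p := fun f => Phi T w (X (j + 1) * f) = 0)] at hj'
        obtain ⟨u, hu⟩ := ih j (hS.forall.2 hw) hj hj'
        exact ⟨_, conGen_swap hu (.of _ _ (.gg j i hij))⟩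
  | mul_h w i ih =>
    simp only [mul_of_h_apply] at hw hj hj'
    simp only [map_mul (Rop i)] at hw hj hj'
    have hS := Rop.surjective i
    rcases lt_trichotomy j i with h | rfl | h
    · obtain ⟨i, rfl, hi⟩ := PNat.exists_eq_add_one_of_lt h
      rcases hi.eq_or_lt with rfl | hi
      · simp [Rop.X_self] at hj'
      · have hi' : j + 1 < i + 1 := add_lt_add_left hi 1
        simp only [Rop.X_of_lt h, Rop.X_of_lt hi'] at hw hj hj'
        rw [← hS.forall (p := fun f => Phi T w (X j * f) = 0)] at hj
        rw [← hS.forall (p := fun f => Phi T w (X (j + 1) * f) = 0)] at hj'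
        obtain ⟨u, hu⟩ := ih j (hS.forall.2 hw) hj hj'
        exact ⟨_, conGen_swap hu ((conGen thompsonRel).symm (.of _ _ (.hg i j hi)))⟩
    · simp [Rop.X_self] at hj
    · obtain ⟨j, rfl, hij⟩ := PNat.exists_eq_add_one_of_lt h
      simp only [Rop.X_add_one_of_le hij, Rop.X_add_one_of_le h.le] at hw hj hj'
      rw [← hS.forall (p := fun f => Phi T w (X j * f) = 0)] at hj
      rw [← hS.forall (p := fun f => Phi T w (X (j + 1) * f) = 0)] at hj'
      obtain ⟨u, hu⟩ := ih j (hS.forall.2 hw) hj hj'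
      exact ⟨_, conGen_swap hu (.of _ _ (.gh j i hij))⟩

theorem eq_one_of_eq_id (w : W) (hw : ∀ f, Phi T w f = f) : w = 1 := by
  induction w using word_induction with
  | one => rfl
  | mul_g w i _ =>
    have h := hw (X i * X (i + 1))
    rw [mul_of_g_apply, hT.X_self_mul, Rop.X_self, map_zero] at h
    exact absurd h.symm (mul_ne_zero (X_ne_zero i) (X_ne_zero (i + 1)))
  | mul_h w i _ =>
    have h := hw (X i)
    rw [mul_of_h_apply, Rop.X_self, map_zero] at h
    exact absurd h.symm (X_ne_zero i)

theorem conGen_of_eq {w w' : W} (h : Phi T w = Phi T w') : conGen thompsonRel w w' := by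
  induction w using word_induction generalizing w' with
  | one =>
    rw [eq_one_of_eq_id hT w' fun f => by rw [← h, one_apply]]
    exact (conGen thompsonRel).refl 1
  | mul_g w j ih =>
    obtain ⟨u, hu⟩ : ∃ u, conGen thompsonRel w' (u * of (.g j)) := by
      apply exists_conGen_mul_g hT <;> simp only [← h, mul_of_g_apply]
      · simp [hT.X_self_mul, Rop.X_self]
      · simp only [hT.X_self_mul]
        exact fun H => not_forall_eq_zero hT w ((Rop.surjective _).forall.2 H)
      · simp only [hT.X_add_one_mul, map_neg, neg_eq_zero]
        exact fun H => not_forall_eq_zero hT w ((Rop.surjective _).forall.2 H)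
    have hwu : Phi T w = Phi T u := LinearMap.ext <| (hT.surjective j).forall.2 fun f => by
      rw [← mul_of_g_apply, ← mul_of_g_apply, h, eq_of_conGen hT hu]
    exact (conGen thompsonRel).trans
      ((conGen thompsonRel).mul (ih hwu) ((conGen thompsonRel).refl _))
      ((conGen thompsonRel).symm hu)
  | mul_h w j ih =>
    obtain ⟨u, hu⟩ : ∃ u, conGen thompsonRel w' (u * of (.h j)) := by
      apply exists_conGen_mul_h hT
      simp only [← h, mul_of_h_apply]
      simp [Rop.X_self]
    have hwu : Phi T w = Phi T u := LinearMap.ext <| (Rop.surjective j).forall.2 fun f => by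
      rw [← mul_of_h_apply, ← mul_of_h_apply, h, eq_of_conGen hT hu]
    exact (conGen thompsonRel).trans
      ((conGen thompsonRel).mul (ih hwu) ((conGen thompsonRel).refl _))
      ((conGen thompsonRel).symm hu)

end Phi

theorem stmt9 (T : ℕ+ → Module.End ℤ PolyP)
    (hT : ∀ (i : ℕ+) (f : PolyP),
      (MvPolynomial.X i : PolyP) * T i f = Rop (i + 1) f - Rop i f)
    (w w' : W) :
    Phi T w = Phi T w' ↔ conGen thompsonRel w w' :=
  ⟨Phi.conGen_of_eq hT, Phi.eq_of_conGen hT⟩
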